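/- Let a and b be nonnegative integers and set α = 2^a·(1+√2)^b·√2 ∈ ℝ, whose Galois conjugate is σ(α) = −2^a·(1−√2)^b·√2. If α ≥ 2 and σ(α) ≥ 2, and N(α−1) divides T(α−1)² in ℤ (i.e., α−1 is an algebraic d-number), then b = 0, i.e., α ∈ ℤ. -/

import Mathlib

theorem pell_aux (b : ℕ) : ∃ p q : ℤ, 1 ≤ p ∧ 0 ≤ q ∧ (p ^ 2 - 2 * q ^ 2) ^ 2 = 1 ∧
    (1 + Real.sqrt 2) ^ b = (p : ℝ) + q * Real.sqrt 2 ∧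
    (1 - Real.sqrt 2) ^ b = (p : ℝ) - q * Real.sqrt 2 := by
  have hs : Real.sqrt 2 ^ 2 = 2 := Real.sq_sqrt (by norm_num)
  induction b with
  | zero => exact ⟨1, 0, by norm_num, by norm_num, by norm_num, by simp, by simp⟩
  | succ n ih =>
    obtain ⟨p, q, hp, hq, h, h1, h2⟩ := ih
    refine ⟨p + 2 * q, p + q, by linarith, by linarith, ?_, ?_, ?_⟩
    · rw [← h]; ring
    · rw [pow_succ, h1]; push_cast; linear_combination (q : ℝ) * hs
    · rw [pow_succ, h2]; push_cast; linear_combination (q : ℝ) * hs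

/-- Let `α = 2^a·(1+√2)^b·√2` with Galois conjugate `σ(α) = −2^a·(1−√2)^b·√2`.  If `α` and
`σ(α)` are both at least `2`, and the norm `N(α−1)` divides the square of the trace
`T(α−1)` in `ℤ` (i.e. `α − 1` is an algebraic d-number), then `b = 0`, i.e. `α ∈ ℤ`. -/
theorem stmt12 (a b : ℕ)
    (h1 : (2 : ℝ) ≤ 2 ^ a * (1 + Real.sqrt 2) ^ b * Real.sqrt 2)
    (h2 : (2 : ℝ) ≤ -(2 ^ a * (1 - Real.sqrt 2) ^ b * Real.sqrt 2))
    (hd : ∃ N T : ℤ,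
      (N : ℝ) = (2 ^ a * (1 + Real.sqrt 2) ^ b * Real.sqrt 2 - 1) *
        (-(2 ^ a * (1 - Real.sqrt 2) ^ b * Real.sqrt 2) - 1) ∧
      (T : ℝ) = (2 ^ a * (1 + Real.sqrt 2) ^ b * Real.sqrt 2 - 1) +
        (-(2 ^ a * (1 - Real.sqrt 2) ^ b * Real.sqrt 2) - 1) ∧
      N ∣ T ^ 2) :
    b = 0 := by
  exfalso
  obtain ⟨N, T, hN, hT, hdvd⟩ := hd
  obtain ⟨p, q, hp, hq, hpell, e1, e2⟩ := pell_aux b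
  have hs : Real.sqrt 2 ^ 2 = 2 := Real.sq_sqrt (by norm_num)
  have hs0 : 0 < Real.sqrt 2 := by positivity
  rw [e1] at h1 hN hT
  rw [e2] at h2 hN hT
  generalize Real.sqrt 2 = s at *
  have hx : (0 : ℝ) < 2 ^ a := by positivity
  have hNi : N = (2 * 2 ^ a * q - 1) ^ 2 - 2 * (2 ^ a) ^ 2 * p ^ 2 := by
    have : (N : ℝ) = (2 * 2 ^ a * q - 1) ^ 2 - 2 * (2 ^ a) ^ 2 * p ^ 2 := by
      rw [hN]
      linear_combination ((2 : ℝ) ^ a * 2 ^ a * q ^ 2 * (s ^ 2 + 2) - 2 ^ a * 2 ^ a * p ^ 2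
        - 2 * 2 ^ a * q) * hs
    exact_mod_cast this
  have hTi : T = 2 * (2 * 2 ^ a * q - 1) := by
    have : (T : ℝ) = 2 * (2 * 2 ^ a * q - 1) := by
      rw [hT]
      linear_combination (2 * (2 : ℝ) ^ a * q) * hs
    exact_mod_cast this
  have hdv : N ∣ 2 ^ (3 + 2 * a) * p ^ 2 := by
    have : (2 : ℤ) ^ (3 + 2 * a) * p ^ 2 = T ^ 2 - 4 * N := by
      rw [hNi, hTi]; ring
    rw [this]
    exact dvd_sub hdvd (Dvd.intro_left _ rfl)
  have hcop : IsCoprime N 2 := by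
    refine ⟨1, -(2 * (2 ^ a) ^ 2 * q ^ 2 - 2 * 2 ^ a * q - (2 ^ a) ^ 2 * p ^ 2), ?_⟩
    rw [hNi]; ring
  have hle : N ≤ p ^ 2 :=
    Int.le_of_dvd (by positivity) (hcop.pow_right.dvd_of_dvd_mul_left hdv)
  have hleR : (N : ℝ) ≤ (p : ℝ) ^ 2 := by exact_mod_cast hle
  have hpR : (1 : ℝ) ≤ p := by exact_mod_cast hp
  have hqR : (0 : ℝ) ≤ q := by exact_mod_cast hq
  have hd0 : 0 < q * s - p := by
    by_contra hc
    have : 0 ≤ 2 ^ a * s * (p - q * s) := mul_nonneg (by positivity) (by linarith)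
    nlinarith
  have he0 : (1 : ℝ) ≤ q * s + p := by nlinarith [mul_nonneg hqR hs0.le]
  have hde : (q * s - p) * (q * s + p) = 1 := by
    have h3 : (q * s - p) * (q * s + p) = 2 * (q : ℝ) ^ 2 - p ^ 2 := by
      linear_combination (q : ℝ) ^ 2 * hs
    have h4 : ((p : ℝ) ^ 2 - 2 * q ^ 2) ^ 2 = 1 := by exact_mod_cast hpell
    have h5 : 0 < (q * s - p) * (q * s + p) := mul_pos hd0 (by linarith)
    rw [h3] at h5 ⊢
    nlinarith
  set x : ℝ := 2 ^ a
  have hxs : 2 * (q * s + p) ≤ x * s := by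
    have := mul_le_mul_of_nonneg_right h2 (by linarith : 0 ≤ q * s + p)
    linear_combination this + x * s * hde
  have hx2 : 2 * (q * s + p) ^ 2 ≤ x ^ 2 := by
    have := pow_le_pow_left₀ (by linarith) hxs 2
    rw [mul_pow, mul_pow, hs] at this
    linarith
  have hAB : (x * (p + q * s) * s) * (-(x * (p - q * s) * s)) = 2 * x ^ 2 := by
    linear_combination x ^ 2 * s ^ 2 * hde + x ^ 2 * hs
  have hNge : x ^ 2 / 2 ≤ N := by
    rw [hN]
    nlinarith [mul_nonneg (sub_nonneg.2 h1) (sub_nonneg.2 h2)]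
  have : (p : ℝ) ^ 2 < (q * s + p) ^ 2 := by
    have : (p : ℝ) < q * s + p := by linarith
    exact pow_lt_pow_left₀ this (by linarith) (by norm_num)
  linarith
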